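/- arXiv:2311.09442 — 7 statements merged into one kernel-verified Lean document; each statement's English description precedes it below -/
import Mathlib

section
/- For every real number y, the function f1 is not continuous at the point (b(y), y), where b(y) = 7/10 + sin(2πy)/5; that is, f1 has an ordinary fault (a discontinuity) at every point of the curve x = b(y). -/
open Real Filter Topology

noncomputable def f1 : ℝ × ℝ → ℝ := fun p =>
  if p.1 ≤ 7/10 + Real.sin (2 * Real.pi * p.2) / 5 then
    |p.1 - 2/5 - Real.sin (2 * Real.pi * p.2) / 10|
  else
    |p.1 - 2/5 - Real.sin (2 * Real.pi * p.2) / 10 - 1/5|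

noncomputable def c : ℝ → ℝ := fun y => 2/5 + Real.sin (2 * Real.pi * y) / 10

noncomputable def b : ℝ → ℝ := fun y => 7/10 + Real.sin (2 * Real.pi * y) / 5

theorem f1_discontinuous_on_ordinary_fault :
    ∀ y : ℝ, ¬ ContinuousAt f1 (b y, y) := by
  intro y hcont
  have hs := Real.neg_one_le_sin (2 * Real.pi * y)
  have hslice : Tendsto (fun x : ℝ => f1 (x, y)) (𝓝[>] (b y)) (𝓝 (f1 (b y, y))) := by
    have hpair : ContinuousAt (fun x : ℝ => (x, y)) (b y) := by fun_prop
    exact (ContinuousAt.comp (f := fun x : ℝ => (x, y)) hcont hpair).tendsto.mono_left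
      nhdsWithin_le_nhds
  have hright : Tendsto (fun x : ℝ => f1 (x, y)) (𝓝[>] (b y))
      (𝓝 |b y - 2/5 - Real.sin (2 * Real.pi * y) / 10 - 1/5|) := by
    have hbranch : ContinuousAt
        (fun x : ℝ => |x - 2/5 - Real.sin (2 * Real.pi * y) / 10 - 1/5|) (b y) := by fun_prop
    refine (hbranch.tendsto.mono_left nhdsWithin_le_nhds).congr' ?_
    filter_upwards [self_mem_nhdsWithin] with x hx
    exact (if_neg (not_le.mpr hx)).symm
  have heq := tendsto_nhds_unique hslice hright
  have hval : f1 (b y, y) = |b y - 2/5 - Real.sin (2 * Real.pi * y) / 10| :=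
    if_pos le_rfl
  rw [hval, abs_of_nonneg (by unfold b; linarith), abs_of_nonneg (by unfold b; linarith)] at heq
  linarith
end

section
/- The image of the unit square [0,1] × [0,1] under f1 is exactly the interval [0, 1/2]; that is, f1 restricted to [0,1]² has range [0, 0.5]. -/
open Real Filter Topology

theorem f1_range_on_unit_square :
    f1 '' (Set.Icc (0:ℝ) 1 ×ˢ Set.Icc (0:ℝ) 1) = Set.Icc 0 (1/2) := by
  apply Set.Subset.antisymm
  · rintro _ ⟨⟨x, y⟩, ⟨⟨hx0, hx1⟩, -⟩, rfl⟩
    have hs_ge := Real.neg_one_le_sin (2 * Real.pi * y)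
    have hs_le := Real.sin_le_one (2 * Real.pi * y)
    dsimp only at hx0 hx1
    unfold f1
    dsimp only
    split_ifs with h
    · exact ⟨abs_nonneg _, abs_le.2 ⟨by linarith, by linarith⟩⟩
    · rw [not_le] at h
      exact ⟨abs_nonneg _, abs_le.2 ⟨by linarith, by linarith⟩⟩
  · rintro t ⟨ht0, ht1⟩
    have hs : Real.sin (2 * Real.pi * (1/4)) = 1 := by
      rw [show 2 * Real.pi * (1/4) = Real.pi / 2 by ring, Real.sin_pi_div_two]
    refine ⟨(1/2 - t, 1/4), ⟨⟨by dsimp only; linarith, by dsimp only; linarith⟩,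
      ⟨by norm_num, by norm_num⟩⟩, ?_⟩
    unfold f1
    dsimp only
    rw [hs, if_pos (by linarith), show 1/2 - t - 2/5 - 1/10 = -t by ring, abs_neg,
      abs_of_nonneg ht0]
end

section
/- Define g⁺ : ℝ × ℝ → ℝ by g⁺(x,y) = x − 2/5 − sin(2πy)/10 and g⁻ = −g⁺. Then f1 coincides with g⁺ on the set {(x,y) : c(y) ≤ x ≤ b(y)} and with g⁻ on the set {(x,y) : x ≤ c(y)}, both g⁺ and g⁻ are everywhere differentiable, and at every point (c(y), y) of the gradient-fault curve the difference of their gradients equals the vector (2, −(2π/5)·cos(2πy)); in particular, the magnitude of the gradient jump of f1 across the curve x = c(y) varies with y. -/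
open Real Filter Topology

noncomputable def gp : ℝ × ℝ → ℝ := fun p => p.1 - 2/5 - Real.sin (2 * Real.pi * p.2) / 10

noncomputable def gm : ℝ × ℝ → ℝ := fun p => -gp p

theorem hasFDerivAt_gp (p : ℝ × ℝ) :
    HasFDerivAt gp
      (ContinuousLinearMap.fst ℝ ℝ ℝ -
        (Real.pi / 5 * Real.cos (2 * Real.pi * p.2)) • ContinuousLinearMap.snd ℝ ℝ ℝ) p := by
  have hsin : HasDerivAt (fun y : ℝ => Real.sin (2 * Real.pi * y) / 10)
      (Real.pi / 5 * Real.cos (2 * Real.pi * p.2)) p.2 :=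
    ((((hasDerivAt_id' p.2).const_mul (2 * Real.pi)).sin).div_const 10).congr_deriv (by ring)
  exact (hasFDerivAt_fst.sub_const (2/5)).sub (hsin.comp_hasFDerivAt p hasFDerivAt_snd)

theorem hasFDerivAt_gm (p : ℝ × ℝ) :
    HasFDerivAt gm
      (-(ContinuousLinearMap.fst ℝ ℝ ℝ -
        (Real.pi / 5 * Real.cos (2 * Real.pi * p.2)) • ContinuousLinearMap.snd ℝ ℝ ℝ)) p :=
  (hasFDerivAt_gp p).neg

theorem c_le_b (y : ℝ) : c y ≤ b y := by
  unfold c b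
  linarith [Real.neg_one_le_sin (2 * Real.pi * y)]

theorem f1_eq_abs_gp {p : ℝ × ℝ} (h : p.1 ≤ b p.2) : f1 p = |gp p| :=
  if_pos h

theorem gp_eq_sub_c (p : ℝ × ℝ) : gp p = p.1 - c p.2 := by
  unfold gp c
  ring

theorem f1_gradient_jump_across_gradient_fault :
    (∀ p : ℝ × ℝ, c p.2 ≤ p.1 → p.1 ≤ b p.2 → f1 p = gp p) ∧
    (∀ p : ℝ × ℝ, p.1 ≤ c p.2 → f1 p = gm p) ∧
    Differentiable ℝ gp ∧ Differentiable ℝ gm ∧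
    (∀ y : ℝ, ∀ v : ℝ × ℝ,
      (fderiv ℝ gp (c y, y) - fderiv ℝ gm (c y, y)) v =
        2 * v.1 + (-(2 * Real.pi / 5) * Real.cos (2 * Real.pi * y)) * v.2) := by
  refine ⟨fun p hc hb => ?_, fun p hc => ?_, fun p => (hasFDerivAt_gp p).differentiableAt,
    fun p => (hasFDerivAt_gm p).differentiableAt, fun y v => ?_⟩
  · rw [f1_eq_abs_gp hb, abs_of_nonneg]
    rw [gp_eq_sub_c]
    exact sub_nonneg.2 hc
  · rw [f1_eq_abs_gp (hc.trans (c_le_b p.2)), abs_of_nonpos, gm]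
    rw [gp_eq_sub_c]
    exact sub_nonpos.2 hc
  · rw [(hasFDerivAt_gp _).fderiv, (hasFDerivAt_gm _).fderiv]
    simp
    ring
end

section
/- For every real number x with x > 1, the function y ↦ f2(x,y) has a right-hand limit L⁺ at y = 0 (as y tends to 0 from within (0,∞)) and a left-hand limit L⁻ at y = 0 (as y tends to 0 from within (−∞,0)), and the jump satisfies L⁺ − L⁻ = 2·arcosh(x) = 2·log(x + √(x² − 1)) > 0; in particular f2 is discontinuous at every point (x, 0) with x > 1. -/
open Real Filter Topology Complex

noncomputable def arcsinC : ℂ → ℂ := fun z =>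
  -Complex.I * Complex.log (Complex.I * z + (1 - z ^ 2) ^ ((1 : ℂ) / 2))

noncomputable def f2 : ℝ × ℝ → ℝ := fun p =>
  (arcsinC ((p.1 : ℂ) + (p.2 : ℂ) * Complex.I) +
    arcsinC (Complex.I * ((p.1 : ℂ) - (p.2 : ℂ) * Complex.I))).im

theorem arcsinC_im (z : ℂ) :
    (arcsinC z).im = -Real.log ‖Complex.I * z + (1 - z ^ 2) ^ ((1 : ℂ) / 2)‖ := by
  simp [arcsinC, Complex.log_re]

theorem exp_log_half {r : ℝ} (hr : 0 < r) :
    Complex.exp ((Real.log r : ℂ) * (1 / 2)) = (Real.sqrt r : ℂ) := by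
  rw [Real.sqrt_eq_rpow, Real.rpow_def_of_pos hr]
  push_cast
  rfl

theorem exp_pi_I_half : Complex.exp ((π : ℂ) * Complex.I * (1 / 2)) = Complex.I := by
  rw [mul_one_div, mul_div_right_comm, Complex.exp_pi_div_two_mul_I]

theorem exp_neg_pi_I_half : Complex.exp (-((π : ℂ) * Complex.I * (1 / 2))) = -Complex.I := by
  rw [Complex.exp_neg, exp_pi_I_half, Complex.inv_I]

/-- The limit of the principal square root at a negative real number, along any filter on which
the principal logarithm has a limit `log r + θ`. -/
theorem tendsto_cpow_half_of_tendsto_log {l : Filter ℝ} {g : ℝ → ℂ} {r : ℝ} {θ : ℂ} (hr : 0 < r)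
    (hg : ∀ᶠ y in l, g y ≠ 0)
    (h : Tendsto (fun y => Complex.log (g y)) l (𝓝 ((Real.log r : ℂ) + θ))) :
    Tendsto (fun y => g y ^ ((1 : ℂ) / 2)) l
      (𝓝 ((Real.sqrt r : ℂ) * Complex.exp (θ * (1 / 2)))) := by
  have h1 := (Complex.continuous_exp.tendsto _).comp (h.mul_const ((1 : ℂ) / 2))
  rw [add_mul, Complex.exp_add, exp_log_half hr] at h1
  refine h1.congr' ?_
  filter_upwards [hg] with y hy
  simp [Complex.cpow_def_of_ne_zero hy]

theorem one_sub_sq_im (x y : ℝ) :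
    (1 - ((x : ℂ) + (y : ℂ) * Complex.I) ^ 2).im = -(2 * x * y) := by
  simp [pow_two]
  ring

theorem tendsto_one_sub_sq (x : ℝ) :
    Tendsto (fun y : ℝ => 1 - ((x : ℂ) + (y : ℂ) * Complex.I) ^ 2) (𝓝 0)
      (𝓝 (((1 - x ^ 2 : ℝ)) : ℂ)) := by
  have : Continuous (fun y : ℝ => 1 - ((x : ℂ) + (y : ℂ) * Complex.I) ^ 2) := by fun_prop
  simpa using this.tendsto 0

theorem tendsto_sqrt_one_sub_sq_right {x : ℝ} (hx : 1 < x) :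
    Tendsto (fun y : ℝ => (1 - ((x : ℂ) + (y : ℂ) * Complex.I) ^ 2) ^ ((1 : ℂ) / 2)) (𝓝[>] 0)
      (𝓝 (-((Real.sqrt (x ^ 2 - 1) : ℂ) * Complex.I))) := by
  have him : ∀ᶠ y : ℝ in 𝓝[>] 0, (1 - ((x : ℂ) + (y : ℂ) * Complex.I) ^ 2).im < 0 := by
    filter_upwards [self_mem_nhdsWithin] with y hy
    have hy : 0 < y := hy
    rw [one_sub_sq_im]
    have : 0 < 2 * x * y := by positivity
    linarith
  have hr : 0 < x ^ 2 - 1 := by nlinarith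
  have hlog := (Complex.tendsto_log_nhdsWithin_im_neg_of_re_neg_of_im_zero
    (z := ((1 - x ^ 2 : ℝ) : ℂ)) (by rw [Complex.ofReal_re]; linarith) (Complex.ofReal_im _)).comp
    (tendsto_nhdsWithin_iff.2 ⟨(tendsto_one_sub_sq x).mono_left nhdsWithin_le_nhds, him⟩)
  rw [Complex.norm_real, Real.norm_eq_abs, abs_of_neg (by linarith), neg_sub,
    sub_eq_add_neg (Complex.ofReal _)] at hlog
  have h := tendsto_cpow_half_of_tendsto_log hr
    (him.mono fun y hy h0 => by rw [h0] at hy; simp at hy) hlog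
  rwa [neg_mul, exp_neg_pi_I_half, mul_neg] at h

theorem tendsto_sqrt_one_sub_sq_left {x : ℝ} (hx : 1 < x) :
    Tendsto (fun y : ℝ => (1 - ((x : ℂ) + (y : ℂ) * Complex.I) ^ 2) ^ ((1 : ℂ) / 2)) (𝓝[<] 0)
      (𝓝 ((Real.sqrt (x ^ 2 - 1) : ℂ) * Complex.I)) := by
  have him : ∀ᶠ y : ℝ in 𝓝[<] 0, 0 < (1 - ((x : ℂ) + (y : ℂ) * Complex.I) ^ 2).im := by
    filter_upwards [self_mem_nhdsWithin] with y hy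
    have hy : y < 0 := hy
    rw [one_sub_sq_im]
    nlinarith
  have hr : 0 < x ^ 2 - 1 := by nlinarith
  have hlog := (Complex.tendsto_log_nhdsWithin_im_nonneg_of_re_neg_of_im_zero
    (z := ((1 - x ^ 2 : ℝ) : ℂ)) (by rw [Complex.ofReal_re]; linarith) (Complex.ofReal_im _)).comp
    (tendsto_nhdsWithin_iff.2 ⟨(tendsto_one_sub_sq x).mono_left nhdsWithin_le_nhds,
      him.mono fun _ => le_of_lt⟩)
  rw [Complex.norm_real, Real.norm_eq_abs, abs_of_neg (by linarith), neg_sub] at hlog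
  have h := tendsto_cpow_half_of_tendsto_log hr
    (him.mono fun y hy h0 => by rw [h0] at hy; simp at hy) hlog
  rwa [exp_pi_I_half] at h

/-- The second summand of `f2` is continuous across the real axis. -/
theorem tendsto_arcsinC_I_mul_im (x : ℝ) :
    Tendsto (fun y : ℝ => (arcsinC (Complex.I * ((x : ℂ) - (y : ℂ) * Complex.I))).im) (𝓝 0)
      (𝓝 (-Real.log (Real.sqrt (1 + x ^ 2) - x))) := by
  have hpos : 0 < 1 + x ^ 2 := by positivity
  have hlt : 0 < Real.sqrt (1 + x ^ 2) - x :=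
    sub_pos.2 (Real.lt_sqrt_of_sq_lt (by linarith))
  have hb : (1 - (Complex.I * ((x : ℂ) - ((0 : ℝ) : ℂ) * Complex.I)) ^ 2) =
      ((1 + x ^ 2 : ℝ) : ℂ) := by
    push_cast
    rw [zero_mul, sub_zero, mul_pow, Complex.I_sq]
    ring
  have hval : Complex.I * (Complex.I * ((x : ℂ) - ((0 : ℝ) : ℂ) * Complex.I)) +
      (1 - (Complex.I * ((x : ℂ) - ((0 : ℝ) : ℂ) * Complex.I)) ^ 2) ^ ((1 : ℂ) / 2) =
      ((Real.sqrt (1 + x ^ 2) - x : ℝ) : ℂ) := by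
    rw [hb, Real.sqrt_eq_rpow, Complex.ofReal_sub, Complex.ofReal_cpow hpos.le, ← mul_assoc,
      Complex.I_mul_I]
    push_cast
    ring
  have hc : ContinuousAt (fun y : ℝ =>
      Complex.I * (Complex.I * ((x : ℂ) - (y : ℂ) * Complex.I)) +
      (1 - (Complex.I * ((x : ℂ) - (y : ℂ) * Complex.I)) ^ 2) ^ ((1 : ℂ) / 2)) 0 := by
    refine ContinuousAt.add (by fun_prop) (ContinuousAt.cpow (by fun_prop) (by fun_prop) ?_)
    rw [hb]
    exact Complex.ofReal_mem_slitPlane.2 hpos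
  have ht := hc.tendsto
  rw [hval] at ht
  have hn := (ht.norm.log (norm_ne_zero_iff.2 (Complex.ofReal_ne_zero.2 hlt.ne'))).neg
  rw [Complex.norm_real, Real.norm_of_nonneg hlt.le] at hn
  simpa only [arcsinC_im] using hn

/-- A one-sided limit `t * I` of the square root in `arcsinC (x + iy)` determines the corresponding
one-sided limit of `f2`. -/
theorem tendsto_f2_of_tendsto_sqrt {x t : ℝ} {l : Filter ℝ} (hl : l ≤ 𝓝 0) (hxt : 0 < x + t)
    (h : Tendsto (fun y : ℝ => (1 - ((x : ℂ) + (y : ℂ) * Complex.I) ^ 2) ^ ((1 : ℂ) / 2)) l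
      (𝓝 ((t : ℂ) * Complex.I))) :
    Tendsto (fun y => f2 (x, y)) l
      (𝓝 (-Real.log (x + t) + -Real.log (Real.sqrt (1 + x ^ 2) - x))) := by
  have hlin : Tendsto (fun y : ℝ => Complex.I * ((x : ℂ) + (y : ℂ) * Complex.I)) l
      (𝓝 (Complex.I * x)) := by
    have : Continuous (fun y : ℝ => Complex.I * ((x : ℂ) + (y : ℂ) * Complex.I)) := by fun_prop
    simpa using (this.tendsto 0).mono_left hl
  have hnorm : ‖Complex.I * (x : ℂ) + (t : ℂ) * Complex.I‖ = x + t := by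
    rw [mul_comm Complex.I, ← add_mul, ← Complex.ofReal_add, norm_mul, Complex.norm_I, mul_one,
      Complex.norm_real, Real.norm_of_nonneg hxt.le]
  have hn := (hlin.add h).norm
  rw [hnorm] at hn
  have := (hn.log hxt.ne').neg.add ((tendsto_arcsinC_I_mul_im x).mono_left hl)
  simpa only [f2, Complex.add_im, arcsinC_im] using this

theorem f2_jump_across_horizontal_fault :
    ∀ x : ℝ, 1 < x →
      ∃ Lp Lm : ℝ,
        Tendsto (fun y => f2 (x, y)) (𝓝[Set.Ioi (0:ℝ)] 0) (𝓝 Lp) ∧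
        Tendsto (fun y => f2 (x, y)) (𝓝[Set.Iio (0:ℝ)] 0) (𝓝 Lm) ∧
        Lp - Lm = 2 * Real.log (x + Real.sqrt (x ^ 2 - 1)) ∧
        0 < Lp - Lm ∧
        ¬ ContinuousAt f2 (x, 0) := by
  intro x hx
  have hs0 : 0 ≤ Real.sqrt (x ^ 2 - 1) := Real.sqrt_nonneg _
  have hsx : Real.sqrt (x ^ 2 - 1) < x := (Real.sqrt_lt' (by linarith)).2 (by linarith)
  have hsq : Real.sqrt (x ^ 2 - 1) ^ 2 = x ^ 2 - 1 := Real.sq_sqrt (by nlinarith)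
  have hp := tendsto_f2_of_tendsto_sqrt (x := x) (t := -Real.sqrt (x ^ 2 - 1))
    nhdsWithin_le_nhds (by linarith) (by simpa using tendsto_sqrt_one_sub_sq_right hx)
  have hm := tendsto_f2_of_tendsto_sqrt (x := x) (t := Real.sqrt (x ^ 2 - 1))
    nhdsWithin_le_nhds (by linarith) (tendsto_sqrt_one_sub_sq_left hx)
  have hinv : Real.log (x + -Real.sqrt (x ^ 2 - 1)) = -Real.log (x + Real.sqrt (x ^ 2 - 1)) := by
    rw [← Real.log_inv]
    congr 1
    exact eq_inv_of_mul_eq_one_left (by linear_combination -hsq)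
  have hlog : 0 < Real.log (x + Real.sqrt (x ^ 2 - 1)) := Real.log_pos (by linarith)
  refine ⟨_, _, hp, hm, by rw [hinv]; ring, by rw [hinv]; linarith, fun hc => ?_⟩
  have hline : Tendsto (fun y : ℝ => f2 (x, y)) (𝓝 0) (𝓝 (f2 (x, 0))) :=
    hc.tendsto.comp (Continuous.prodMk_right x).continuousAt
  have h1 := tendsto_nhds_unique hp (hline.mono_left nhdsWithin_le_nhds)
  have h2 := tendsto_nhds_unique hm (hline.mono_left nhdsWithin_le_nhds)
  rw [hinv] at h1
  linarith
end

section
/- For every real number y with y > 1, the function x ↦ f2(x,y) has a right-hand limit M⁺ at x = 0 (as x tends to 0 from within (0,∞)) and a left-hand limit M⁻ at x = 0 (as x tends to 0 from within (−∞,0)), and the jump satisfies M⁺ − M⁻ = 2·arcosh(y) = 2·log(y + √(y² − 1)) > 0; in particular f2 is discontinuous at every point (0, y) with y > 1. -/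
open Real Filter Topology Complex

theorem exp_half_log_add_pi_mul_I {a : ℝ} (ha : 0 < a) :
    Complex.exp ((Real.log a + π * Complex.I) * ((1 : ℂ) / 2)) = Real.sqrt a * Complex.I := by
  have h : (Real.log a + π * Complex.I) * ((1 : ℂ) / 2)
      = ((Real.log a / 2 : ℝ) : ℂ) + (π : ℂ) / 2 * Complex.I := by
    push_cast; ring
  rw [h, Complex.exp_add, Complex.exp_pi_div_two_mul_I, ← Complex.ofReal_exp,
    ← Real.log_sqrt ha.le, Real.exp_log (Real.sqrt_pos.2 ha)]

theorem exp_half_log_sub_pi_mul_I {a : ℝ} (ha : 0 < a) :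
    Complex.exp ((Real.log a - π * Complex.I) * ((1 : ℂ) / 2)) = -(Real.sqrt a * Complex.I) := by
  have h : (Real.log a - π * Complex.I) * ((1 : ℂ) / 2)
      = (Real.log a + π * Complex.I) * ((1 : ℂ) / 2) - π * Complex.I := by
    ring
  rw [h, Complex.exp_sub_pi_mul_I, exp_half_log_add_pi_mul_I ha]

theorem tendsto_cpow_half_of_im_pos {a : ℝ} (ha : 0 < a) :
    Tendsto (fun w : ℂ => w ^ ((1 : ℂ) / 2)) (𝓝[{w : ℂ | 0 < w.im}] ((-a : ℝ) : ℂ))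
      (𝓝 (Real.sqrt a * Complex.I)) := by
  have h := (Complex.continuousWithinAt_log_of_re_neg_of_im_zero
    (z := ((-a : ℝ) : ℂ)) (by simpa using ha) (by simp)).tendsto.mono_left
      (nhdsWithin_mono _ (fun w (hw : 0 < w.im) => hw.le))
  have hlog : Complex.log ((-a : ℝ) : ℂ) = Real.log a + π * Complex.I := by
    rw [Complex.log, Complex.arg_ofReal_of_neg (by linarith), Complex.norm_real]
    simp
  rw [hlog] at h
  rw [← exp_half_log_add_pi_mul_I ha]
  refine ((h.mul_const ((1 : ℂ) / 2)).cexp).congr' ?_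
  filter_upwards [self_mem_nhdsWithin] with w (hw : 0 < w.im)
  rw [Complex.cpow_def_of_ne_zero]
  rintro rfl
  simp at hw

theorem tendsto_cpow_half_of_im_neg {a : ℝ} (ha : 0 < a) :
    Tendsto (fun w : ℂ => w ^ ((1 : ℂ) / 2)) (𝓝[{w : ℂ | w.im < 0}] ((-a : ℝ) : ℂ))
      (𝓝 (-(Real.sqrt a * Complex.I))) := by
  have h := Complex.tendsto_log_nhdsWithin_im_neg_of_re_neg_of_im_zero
    (z := ((-a : ℝ) : ℂ)) (by simpa using ha) (by simp)
  have hn : ‖((-a : ℝ) : ℂ)‖ = a := by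
    rw [Complex.norm_real, Real.norm_eq_abs, abs_neg, abs_of_pos ha]
  rw [hn] at h
  rw [← exp_half_log_sub_pi_mul_I ha]
  refine ((h.mul_const ((1 : ℂ) / 2)).cexp).congr' ?_
  filter_upwards [self_mem_nhdsWithin] with w (hw : w.im < 0)
  rw [Complex.cpow_def_of_ne_zero]
  rintro rfl
  simp at hw

theorem continuousAt_arcsinC_im_add_mul_I {y : ℝ} :
    ContinuousAt (fun x : ℝ => (arcsinC ((x : ℂ) + (y : ℂ) * Complex.I)).im) 0 := by
  have hw : (1 : ℂ) - (((0 : ℝ) : ℂ) + (y : ℂ) * Complex.I) ^ 2 = ((1 + y ^ 2 : ℝ) : ℂ) := by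
    push_cast
    linear_combination -(y : ℂ) ^ 2 * Complex.I_sq
  have hpos : (0 : ℝ) < 1 + y ^ 2 := by positivity
  have hroot : (((1 + y ^ 2 : ℝ) : ℂ)) ^ ((1 : ℂ) / 2) = (Real.sqrt (1 + y ^ 2) : ℂ) := by
    rw [Real.sqrt_eq_rpow, Complex.ofReal_cpow hpos.le]
    norm_num
  simp only [arcsinC_im]
  have hcont : ContinuousAt (fun x : ℝ => Complex.I * ((x : ℂ) + (y : ℂ) * Complex.I) +
      (1 - ((x : ℂ) + (y : ℂ) * Complex.I) ^ 2) ^ ((1 : ℂ) / 2)) 0 := by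
    refine ContinuousAt.add (by fun_prop) (ContinuousAt.cpow (by fun_prop) (by fun_prop) ?_)
    rw [hw]
    exact Complex.ofReal_mem_slitPlane.2 hpos
  refine (hcont.norm.log ?_).neg
  rw [hw, hroot]
  have hval : Complex.I * (((0 : ℝ) : ℂ) + (y : ℂ) * Complex.I) + (Real.sqrt (1 + y ^ 2) : ℂ)
      = ((Real.sqrt (1 + y ^ 2) - y : ℝ) : ℂ) := by
    push_cast
    linear_combination (y : ℂ) * Complex.I_sq
  rw [hval, norm_ne_zero_iff, Complex.ofReal_ne_zero]
  have : y < Real.sqrt (1 + y ^ 2) := Real.lt_sqrt_of_sq_lt (by linarith)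
  linarith

theorem tendsto_arcsinC_im_of_tendsto_cpow {y c : ℝ} {s : Set ℝ} {t : Set ℂ}
    (hst : ∀ x ∈ s, (1 - (Complex.I * ((x : ℂ) - (y : ℂ) * Complex.I)) ^ 2) ∈ t)
    (ht : Tendsto (fun w : ℂ => w ^ ((1 : ℂ) / 2)) (𝓝[t] ((-(y ^ 2 - 1) : ℝ) : ℂ))
      (𝓝 (c * Complex.I)))
    (hc : 0 < y + c) :
    Tendsto (fun x : ℝ => (arcsinC (Complex.I * ((x : ℂ) - (y : ℂ) * Complex.I))).im)
      (𝓝[s] 0) (𝓝 (-Real.log (y + c))) := by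
  have hw : Tendsto (fun x : ℝ => (1 : ℂ) - (Complex.I * ((x : ℂ) - (y : ℂ) * Complex.I)) ^ 2)
      (𝓝[s] 0) (𝓝[t] ((-(y ^ 2 - 1) : ℝ) : ℂ)) := by
    refine tendsto_nhdsWithin_iff.2 ⟨?_, ?_⟩
    · refine ((Continuous.tendsto' (by fun_prop) _ _ ?_).mono_left nhdsWithin_le_nhds)
      push_cast
      linear_combination (-(y : ℂ) ^ 2 * (Complex.I ^ 2 - 1)) * Complex.I_sq
    · filter_upwards [self_mem_nhdsWithin] with x hx using hst x hx
  have hz : Tendsto (fun x : ℝ => Complex.I * (Complex.I * ((x : ℂ) - (y : ℂ) * Complex.I)))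
      (𝓝[s] 0) (𝓝 (y * Complex.I)) := by
    refine ((Continuous.tendsto' (by fun_prop) _ _ ?_).mono_left nhdsWithin_le_nhds)
    push_cast
    linear_combination (-(y : ℂ) * Complex.I) * Complex.I_sq
  have hsum := (hz.add (ht.comp hw)).norm
  have hnorm : ‖(y : ℂ) * Complex.I + c * Complex.I‖ = y + c := by
    rw [← add_mul, norm_mul, Complex.norm_I, mul_one, ← Complex.ofReal_add, Complex.norm_real,
      Real.norm_eq_abs, abs_of_pos hc]
  rw [hnorm] at hsum
  simpa only [arcsinC_im, Function.comp_def] using (hsum.log hc.ne').neg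

theorem one_sub_sq_I_mul_im (x y : ℝ) :
    (1 - (Complex.I * ((x : ℂ) - (y : ℂ) * Complex.I)) ^ 2).im = -(2 * x * y) := by
  simp [pow_two]
  ring

theorem f2_jump_across_vertical_fault :
    ∀ y : ℝ, 1 < y →
      ∃ Mp Mm : ℝ,
        Tendsto (fun x => f2 (x, y)) (𝓝[Set.Ioi (0:ℝ)] 0) (𝓝 Mp) ∧
        Tendsto (fun x => f2 (x, y)) (𝓝[Set.Iio (0:ℝ)] 0) (𝓝 Mm) ∧
        Mp - Mm = 2 * Real.log (y + Real.sqrt (y ^ 2 - 1)) ∧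
        0 < Mp - Mm ∧
        ¬ ContinuousAt f2 (0, y) := by
  intro y hy
  have ha : 0 < y ^ 2 - 1 := by nlinarith
  have hs : 0 < Real.sqrt (y ^ 2 - 1) := Real.sqrt_pos.2 ha
  have hsq : Real.sqrt (y ^ 2 - 1) ^ 2 = y ^ 2 - 1 := Real.sq_sqrt ha.le
  have hlt : 0 < y + -Real.sqrt (y ^ 2 - 1) := by nlinarith
  have hfirst := (continuousAt_arcsinC_im_add_mul_I (y := y)).tendsto
  have hright := tendsto_arcsinC_im_of_tendsto_cpow (y := y) (s := Set.Ioi 0) (t := {w | w.im < 0})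
    (c := -Real.sqrt (y ^ 2 - 1))
    (fun x (hx : 0 < x) => by
      change _ < (0 : ℝ)
      rw [one_sub_sq_I_mul_im]
      have : 0 < x * y := by positivity
      linarith)
    (by simpa using tendsto_cpow_half_of_im_neg ha) hlt
  have hleft := tendsto_arcsinC_im_of_tendsto_cpow (y := y) (s := Set.Iio 0) (t := {w | 0 < w.im})
    (c := Real.sqrt (y ^ 2 - 1))
    (fun x (hx : x < 0) => by
      change (0 : ℝ) < _
      rw [one_sub_sq_I_mul_im]
      nlinarith)
    (tendsto_cpow_half_of_im_pos ha) (by linarith)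
  have hlog : -Real.log (y + -Real.sqrt (y ^ 2 - 1)) = Real.log (y + Real.sqrt (y ^ 2 - 1)) := by
    rw [← Real.log_inv, inv_eq_of_mul_eq_one_left]
    nlinarith
  rw [hlog] at hright
  have hp := (hfirst.mono_left nhdsWithin_le_nhds).add hright
  have hm := (hfirst.mono_left nhdsWithin_le_nhds).add hleft
  simp only [← Complex.add_im] at hp hm
  have hlogpos : 0 < Real.log (y + Real.sqrt (y ^ 2 - 1)) := Real.log_pos (by linarith)
  refine ⟨_, _, hp, hm, by ring, by linarith, fun hcont => ?_⟩
  have hline : Tendsto (fun x : ℝ => f2 (x, y)) (𝓝 0) (𝓝 (f2 (0, y))) :=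
    hcont.tendsto.comp (Continuous.tendsto' (by fun_prop) _ _ rfl)
  have h1 := tendsto_nhds_unique hp (hline.mono_left nhdsWithin_le_nhds)
  have h2 := tendsto_nhds_unique hm (hline.mono_left nhdsWithin_le_nhds)
  linarith
end

section
/- For every real number x with |x| < 1, the function f2 is continuous at the point (x, 0); that is, f2 has no fault on the segment of the horizontal axis strictly between −1 and 1 (the jump of decreasing intensity towards the center vanishes there and f2 is actually continuous). -/
open Real Filter Topology Complex

theorem arcsinC_continuousAt {z : ℂ} (h₁ : 1 - z ^ 2 ∈ slitPlane)
    (h₂ : Complex.I * z + (1 - z ^ 2) ^ ((1 : ℂ) / 2) ∈ slitPlane) :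
    ContinuousAt arcsinC z := by
  have hpow : ContinuousAt (fun z : ℂ => (1 - z ^ 2) ^ ((1 : ℂ) / 2)) z :=
    ContinuousAt.cpow (by fun_prop) continuousAt_const h₁
  exact continuousAt_const.mul (((continuousAt_const.mul continuousAt_id).add hpow).clog h₂)

theorem ofReal_cpow_one_half {r : ℝ} (hr : 0 ≤ r) :
    (r : ℂ) ^ ((1 : ℂ) / 2) = (√r : ℝ) := by
  rw [Real.sqrt_eq_rpow, Complex.ofReal_cpow hr]
  norm_num

theorem arcsinC_continuousAt_ofReal {x : ℝ} (hx : |x| < 1) : ContinuousAt arcsinC x := by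
  have hpos : 0 < 1 - x ^ 2 := sub_pos.2 ((sq_lt_one_iff_abs_lt_one x).2 hx)
  have hcast : 1 - (x : ℂ) ^ 2 = ((1 - x ^ 2 : ℝ) : ℂ) := by push_cast; ring
  apply arcsinC_continuousAt
  · rw [hcast]
    exact ofReal_mem_slitPlane.2 hpos
  · rw [hcast, ofReal_cpow_one_half hpos.le]
    exact Or.inl (by simpa using Real.sqrt_pos.2 hpos)

theorem arcsinC_continuousAt_I_mul_ofReal (x : ℝ) : ContinuousAt arcsinC (Complex.I * x) := by
  have hpos : 0 < 1 + x ^ 2 := by positivity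
  have hcast : 1 - (Complex.I * x) ^ 2 = ((1 + x ^ 2 : ℝ) : ℂ) := by
    rw [mul_pow, I_sq]; push_cast; ring
  apply arcsinC_continuousAt
  · rw [hcast]
    exact ofReal_mem_slitPlane.2 hpos
  · rw [hcast, ofReal_cpow_one_half hpos.le, ← mul_assoc, I_mul_I]
    have hlt : x < √(1 + x ^ 2) := Real.lt_sqrt_of_sq_lt (by linarith)
    exact Or.inl (by simpa using hlt)

theorem f2_continuous_on_open_horizontal_segment :
    ∀ x : ℝ, |x| < 1 → ContinuousAt f2 (x, 0) := by
  intro x hx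
  have h₁ : ContinuousAt (fun p : ℝ × ℝ => arcsinC ((p.1 : ℂ) + (p.2 : ℂ) * Complex.I)) (x, 0) :=
    ContinuousAt.comp (g := arcsinC) (by simpa using arcsinC_continuousAt_ofReal hx)
      (by fun_prop)
  have h₂ : ContinuousAt
      (fun p : ℝ × ℝ => arcsinC (Complex.I * ((p.1 : ℂ) - (p.2 : ℂ) * Complex.I))) (x, 0) :=
    ContinuousAt.comp (g := arcsinC) (by simpa using arcsinC_continuousAt_I_mul_ofReal x)
      (by fun_prop)
  exact continuous_im.continuousAt.comp (h₁.add h₂)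
end

section
/- For every real number y with |y| < 1, the function f2 is continuous at the point (0, y); that is, f2 has no fault on the segment of the vertical axis strictly between −1 and 1. -/
open Real Filter Topology Complex

theorem cpow_half_sq (u : ℂ) : (u ^ ((1 : ℂ) / 2)) ^ 2 = u := by
  rw [one_div]
  exact Complex.cpow_ofNat_inv_pow u 2

theorem cpow_half_re_nonneg (u : ℂ) : 0 ≤ (u ^ ((1 : ℂ) / 2)).re := by
  rcases eq_or_ne u 0 with rfl | hu
  · simp
  have him : (Complex.log u * (1 / 2)).im = u.arg / 2 := by
    simp [Complex.mul_im, Complex.log_im]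
    ring
  rw [Complex.cpow_def_of_ne_zero hu, Complex.exp_re, him]
  refine mul_nonneg (Real.exp_pos _).le (Real.cos_nonneg_of_mem_Icc ⟨?_, ?_⟩)
  · linarith [Complex.neg_pi_lt_arg u]
  · linarith [Complex.arg_le_pi u]

theorem continuousAt_arcsinC {z : ℂ} (hz : |z.re| < 1) : ContinuousAt arcsinC z := by
  have hre : z.re ^ 2 < 1 := (sq_lt_one_iff_abs_lt_one _).2 hz
  have hu : (1 - z ^ 2).re = 1 - z.re ^ 2 + z.im ^ 2 := by
    simp [sq, Complex.mul_re]
    ring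
  have hslit : 1 - z ^ 2 ∈ Complex.slitPlane :=
    Or.inl (by rw [hu]; nlinarith [sq_nonneg z.im])
  have hpos : 0 < (Complex.I * z + (1 - z ^ 2) ^ ((1 : ℂ) / 2)).re := by
    have hsq := congrArg Complex.re (cpow_half_sq (1 - z ^ 2))
    have hnonneg := cpow_half_re_nonneg (1 - z ^ 2)
    rw [hu] at hsq
    generalize (1 - z ^ 2) ^ ((1 : ℂ) / 2) = s at hsq hnonneg ⊢
    rw [sq, Complex.mul_re] at hsq
    have hlt : z.im < s.re := lt_of_pow_lt_pow_left₀ 2 hnonneg (by nlinarith [sq_nonneg s.im])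
    simpa using hlt
  have hpow : ContinuousAt (fun w : ℂ => (1 - w ^ 2) ^ ((1 : ℂ) / 2)) z :=
    ContinuousAt.cpow (by fun_prop) continuousAt_const hslit
  exact continuousAt_const.mul
    (((continuousAt_const.mul continuousAt_id).add hpow).clog (Or.inl hpos))

theorem f2_continuous_on_open_vertical_segment :
    ∀ y : ℝ, |y| < 1 → ContinuousAt f2 (0, y) := by
  intro y hy
  have h₁ : ContinuousAt
      (fun p : ℝ × ℝ => arcsinC ((p.1 : ℂ) + (p.2 : ℂ) * Complex.I)) (0, y) :=
    ContinuousAt.comp' (continuousAt_arcsinC (by simp)) (by fun_prop)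
  have h₂ : ContinuousAt
      (fun p : ℝ × ℝ => arcsinC (Complex.I * ((p.1 : ℂ) - (p.2 : ℂ) * Complex.I))) (0, y) :=
    ContinuousAt.comp' (continuousAt_arcsinC (by simpa using hy)) (by fun_prop)
  exact Complex.continuous_im.continuousAt.comp' (h₁.add h₂)
end
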